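/- arXiv:0911.4118 — 3 statements merged into one kernel-verified Lean document; each statement's English description precedes it below -/
import Mathlib

section
/- Let Φ = (A; {E_i}; A*; {E*_i}) be a TH system on V with eigenvalue sequence {θ_i}_{i=0}^d and dual eigenvalue sequence {θ*_i}_{i=0}^d. Define U_i = (E*_0 V + ... + E*_i V) ∩ (E_0 V + ... + E_{d-i} V) for 0 ≤ i ≤ d. Then {U_i}_{i=0}^d is a decomposition of V into one-dimensional subspaces whose direct sum is V, and moreover (A - θ_{d-i} I) U_i = U_{i+1} and (A* - θ*_i I) U_i = U_{i-1} for 0 ≤ i ≤ d (where U_{-1} = 0 and U_{d+1} = 0). -/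
/-- A thin Hessenberg system on `V`: multiplicity-free `A`, `Astar` with
orderings of primitive idempotents `E`, `Estar` (eigenvalues `θ`, `θs`)
satisfying the Hessenberg conditions. -/
structure THSystem (K V : Type*) [Field K] [AddCommGroup V] [Module K V] (d : ℕ) where
  A : Module.End K V
  Astar : Module.End K V
  E : Fin (d + 1) → Module.End K V
  Estar : Fin (d + 1) → Module.End K V
  θ : Fin (d + 1) → K
  θs : Fin (d + 1) → K
  finrank_eq : Module.finrank K V = d + 1
  θ_inj : Function.Injective θ
  θs_inj : Function.Injective θs
  sum_E : ∑ i, E i = 1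
  E_mul : ∀ i j, E i * E j = if i = j then E i else 0
  E_ne : ∀ i, E i ≠ 0
  sum_Es : ∑ i, Estar i = 1
  Es_mul : ∀ i j, Estar i * Estar j = if i = j then Estar i else 0
  Es_ne : ∀ i, Estar i ≠ 0
  A_eq : A = ∑ i, θ i • E i
  As_eq : Astar = ∑ i, θs i • Estar i
  EAsE_zero : ∀ i j : Fin (d + 1), (j : ℕ) + 1 < (i : ℕ) → E i * Astar * E j = 0
  EAsE_ne : ∀ i j : Fin (d + 1), (i : ℕ) = (j : ℕ) + 1 → E i * Astar * E j ≠ 0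
  EsAEs_zero : ∀ i j : Fin (d + 1), (j : ℕ) + 1 < (i : ℕ) → Estar i * A * Estar j = 0
  EsAEs_ne : ∀ i j : Fin (d + 1), (i : ℕ) = (j : ℕ) + 1 → Estar i * A * Estar j ≠ 0
/-- The split decomposition subspaces
`U_i = (Σ_{h ≤ i} E*_h V) ⊓ (Σ_{h ≤ d-i} E_h V)`. -/
def splitU {K V : Type*} [Field K] [AddCommGroup V] [Module K V] {d : ℕ}
    (Φ : THSystem K V d) (i : Fin (d + 1)) : Submodule K V :=
  (⨆ h : Fin (d + 1), ⨆ _ : (h : ℕ) ≤ (i : ℕ), LinearMap.range (Φ.Estar h)) ⊓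
  (⨆ h : Fin (d + 1), ⨆ _ : (h : ℕ) ≤ d - (i : ℕ), LinearMap.range (Φ.E h))

section OrthogonalIdempotents

variable {K V ι : Type*} [Field K] [AddCommGroup V] [Module K V]
  {P : ι → Module.End K V}

theorem idempotents_apply_apply [DecidableEq ι]
    (hmul : ∀ i j, P i * P j = if i = j then P i else 0) (i j : ι) (v : V) :
    P i (P j v) = if i = j then P i v else 0 := by
  rw [← Module.End.mul_apply, hmul]
  split_ifs <;> simp

theorem sum_idempotents_apply [Fintype ι] (hsum : ∑ i, P i = 1) (v : V) :
    ∑ i, P i v = v := by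
  simpa using congrArg (fun f : Module.End K V => f v) hsum

theorem eq_zero_of_forall_idempotent_apply_eq_zero [Fintype ι] (hsum : ∑ i, P i = 1) {v : V}
    (h : ∀ i, P i v = 0) : v = 0 := by
  rw [← sum_idempotents_apply hsum v]
  exact Finset.sum_eq_zero fun i _ => h i

theorem idempotent_apply_sum_smul [Fintype ι] [DecidableEq ι]
    (hmul : ∀ i j, P i * P j = if i = j then P i else 0) (c : ι → K) (i : ι) (v : V) :
    P i ((∑ j, c j • P j) v) = c i • P i v := by
  simp [LinearMap.sum_apply, idempotents_apply_apply hmul]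

theorem mem_iSup_range_idempotents_iff [Fintype ι] [DecidableEq ι] (hsum : ∑ i, P i = 1)
    (hmul : ∀ i j, P i * P j = if i = j then P i else 0) (p : ι → Prop) (v : V) :
    v ∈ (⨆ h, ⨆ _ : p h, LinearMap.range (P h)) ↔ ∀ h, ¬ p h → P h v = 0 := by
  constructor
  · intro hv h hh
    have hle : (⨆ h, ⨆ _ : p h, LinearMap.range (P h)) ≤ LinearMap.ker (P h) := by
      refine iSup₂_le fun k hk => ?_
      rintro _ ⟨w, rfl⟩
      rw [LinearMap.mem_ker, idempotents_apply_apply hmul, if_neg]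
      rintro rfl
      exact hh hk
    exact hle hv
  · intro hv
    rw [← sum_idempotents_apply hsum v]
    refine Submodule.sum_mem _ fun h _ => ?_
    by_cases hh : p h
    · exact Submodule.mem_iSup_of_mem h (Submodule.mem_iSup_of_mem hh ⟨v, rfl⟩)
    · rw [hv h hh]
      exact Submodule.zero_mem _

/-- If there are as many nonzero orthogonal idempotents as the dimension, each has rank one. -/
theorem exists_idempotent_apply_eq_smul [Fintype ι] [DecidableEq ι]
    (hmul : ∀ i j, P i * P j = if i = j then P i else 0) (hne : ∀ i, P i ≠ 0)
    (hcard : Fintype.card ι = Module.finrank K V) {i : ι} {x : V} (hx : P i x ≠ 0) (y : V) :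
    ∃ c : K, P i y = c • P i x := by
  have hex : ∀ j, ∃ u, P j u ≠ 0 := fun j => by
    by_contra! h
    exact hne j (LinearMap.ext h)
  choose u hu using hex
  have hli : LinearIndependent K fun j => P j (u j) := by
    rw [Fintype.linearIndependent_iff]
    intro g hg j
    have := congrArg (P j) hg
    simpa [idempotents_apply_apply hmul, hu j] using this
  have : Nonempty ι := ⟨i⟩
  have hspan := hli.span_eq_top_of_card_eq_finrank hcard
  have hmem : ∀ z : V, ∃ c : K, P i z = c • P i (u i) := by
    intro z
    have hz : z ∈ Submodule.span K (Set.range fun j => P j (u j)) := hspan ▸ Submodule.mem_top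
    obtain ⟨c, rfl⟩ := (Submodule.mem_span_range_iff_exists_fun K).1 hz
    exact ⟨c i, by simp [idempotents_apply_apply hmul]⟩
  obtain ⟨a, ha⟩ := hmem x
  obtain ⟨b, hb⟩ := hmem y
  have ha0 : a ≠ 0 := by
    rintro rfl
    exact hx (by simpa using ha)
  exact ⟨b * a⁻¹, by rw [hb, ha, smul_smul, inv_mul_cancel_right₀ ha0]⟩

end OrthogonalIdempotents

namespace THSystem

variable {K V : Type*} [Field K] [AddCommGroup V] [Module K V] {d : ℕ}

/-- The system obtained by exchanging `A` and `Astar`. -/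
def dual (Φ : THSystem K V d) : THSystem K V d where
  A := Φ.Astar
  Astar := Φ.A
  E := Φ.Estar
  Estar := Φ.E
  θ := Φ.θs
  θs := Φ.θ
  finrank_eq := Φ.finrank_eq
  θ_inj := Φ.θs_inj
  θs_inj := Φ.θ_inj
  sum_E := Φ.sum_Es
  E_mul := Φ.Es_mul
  E_ne := Φ.Es_ne
  sum_Es := Φ.sum_E
  Es_mul := Φ.E_mul
  Es_ne := Φ.E_ne
  A_eq := Φ.As_eq
  As_eq := Φ.A_eq
  EAsE_zero := Φ.EsAEs_zero
  EAsE_ne := Φ.EsAEs_ne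
  EsAEs_zero := Φ.EAsE_zero
  EsAEs_ne := Φ.EAsE_ne

theorem splitU_dual (Φ : THSystem K V d) (i j : Fin (d + 1)) (h : (i : ℕ) + j = d) :
    splitU Φ.dual i = splitU Φ j := by
  have hi : d - (i : ℕ) = j := by omega
  have hj : d - (j : ℕ) = i := by omega
  simp only [splitU, hi, hj]
  exact inf_comm _ _

theorem mem_splitU_iff (Φ : THSystem K V d) (i : Fin (d + 1)) (v : V) :
    v ∈ splitU Φ i ↔ (∀ h : Fin (d + 1), (i : ℕ) + 1 ≤ h → Φ.Estar h v = 0) ∧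
      ∀ h : Fin (d + 1), d - (i : ℕ) + 1 ≤ h → Φ.E h v = 0 := by
  rw [splitU, Submodule.mem_inf, mem_iSup_range_idempotents_iff Φ.sum_Es Φ.Es_mul,
    mem_iSup_range_idempotents_iff Φ.sum_E Φ.E_mul]
  simp only [not_le, Nat.succ_le_iff]

theorem E_apply_sub (Φ : THSystem K V d) (h k : Fin (d + 1)) (v : V) :
    Φ.E h ((Φ.A - Φ.θ k • (1 : Module.End K V)) v) = (Φ.θ h - Φ.θ k) • Φ.E h v := by
  simp [Φ.A_eq, idempotent_apply_sum_smul Φ.E_mul, sub_smul, -LinearMap.coe_sum]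

theorem E_apply_sub_eq_zero (Φ : THSystem K V d) {n : ℕ} (k : Fin (d + 1)) (hk : (k : ℕ) = n)
    {v : V} (hv : ∀ h : Fin (d + 1), n + 1 ≤ h → Φ.E h v = 0) (h : Fin (d + 1)) (hh : n ≤ h) :
    Φ.E h ((Φ.A - Φ.θ k • (1 : Module.End K V)) v) = 0 := by
  rw [E_apply_sub]
  rcases eq_or_ne h k with rfl | hne
  · simp
  · rw [hv h (by have := Fin.val_ne_of_ne hne; omega), smul_zero]

theorem Estar_apply_A (Φ : THSystem K V d) {m : ℕ} {v : V}
    (hv : ∀ h : Fin (d + 1), m + 1 ≤ h → Φ.Estar h v = 0) (h : Fin (d + 1)) :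
    Φ.Estar h (Φ.A v) =
      ∑ j : Fin (d + 1), if (j : ℕ) ≤ m then (Φ.Estar h * Φ.A * Φ.Estar j) v else 0 := by
  conv_lhs => rw [← sum_idempotents_apply Φ.sum_Es v]
  rw [map_sum, map_sum]
  refine Finset.sum_congr rfl fun j _ => ?_
  split_ifs with hj
  · rfl
  · rw [hv j (by omega), map_zero, map_zero]

theorem Estar_apply_sub_eq_zero (Φ : THSystem K V d) {m : ℕ} (k : Fin (d + 1)) {v : V}
    (hv : ∀ h : Fin (d + 1), m + 1 ≤ h → Φ.Estar h v = 0) (h : Fin (d + 1)) (hh : m + 2 ≤ h) :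
    Φ.Estar h ((Φ.A - Φ.θ k • (1 : Module.End K V)) v) = 0 := by
  have hA : Φ.Estar h (Φ.A v) = 0 := by
    rw [Φ.Estar_apply_A hv]
    refine Finset.sum_eq_zero fun j _ => ?_
    split_ifs with hj
    · rw [Φ.EsAEs_zero h j (by omega), LinearMap.zero_apply]
    · rfl
  simp [hA, hv h (by omega)]

theorem Estar_apply_sub_ne_zero (Φ : THSystem K V d) (i j k : Fin (d + 1))
    (hj : (j : ℕ) = i + 1) {v : V}
    (hv : ∀ h : Fin (d + 1), (i : ℕ) + 1 ≤ h → Φ.Estar h v = 0) (hi : Φ.Estar i v ≠ 0) :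
    Φ.Estar j ((Φ.A - Φ.θ k • (1 : Module.End K V)) v) ≠ 0 := by
  have hA : Φ.Estar j (Φ.A v) = (Φ.Estar j * Φ.A * Φ.Estar i) v := by
    rw [Φ.Estar_apply_A hv, Finset.sum_eq_single i]
    · simp
    · intro l _ hl
      split_ifs with hli
      · have := Fin.val_ne_of_ne hl
        rw [Φ.EsAEs_zero j l (by omega), LinearMap.zero_apply]
      · rfl
    · simp
  have hsub : Φ.Estar j ((Φ.A - Φ.θ k • (1 : Module.End K V)) v) =
      (Φ.Estar j * Φ.A * Φ.Estar i) v := by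
    simp [← hA, hv j hj.ge]
  rw [hsub]
  intro h0
  refine Φ.EsAEs_ne j i hj (LinearMap.ext fun y => ?_)
  obtain ⟨c, hc⟩ := exists_idempotent_apply_eq_smul Φ.Es_mul Φ.Es_ne
    (by simp [Φ.finrank_eq]) hi y
  simp only [Module.End.mul_apply] at h0
  simp [hc, h0]

/-- The flags induced by `Estar` and `E` are opposite. -/
theorem eq_zero_of_mem_flags (Φ : THSystem K V d) {m n : ℕ} (hmn : m + n ≤ d + 1) {v : V}
    (hm : ∀ h : Fin (d + 1), m ≤ h → Φ.Estar h v = 0)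
    (hn : ∀ h : Fin (d + 1), n ≤ h → Φ.E h v = 0) : v = 0 := by
  induction n generalizing m v with
  | zero => exact eq_zero_of_forall_idempotent_apply_eq_zero Φ.sum_E fun i => hn i (Nat.zero_le _)
  | succ n ihn =>
    induction m with
    | zero =>
      exact eq_zero_of_forall_idempotent_apply_eq_zero Φ.sum_Es fun i => hm i (Nat.zero_le _)
    | succ m ihm =>
      let k : Fin (d + 1) := ⟨n, by omega⟩
      have hw : (Φ.A - Φ.θ k • (1 : Module.End K V)) v = 0 :=
        ihn (m := m + 2) (by omega) (Φ.Estar_apply_sub_eq_zero k hm)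
          (Φ.E_apply_sub_eq_zero k rfl hn)
      have hmv : Φ.Estar ⟨m, by omega⟩ v = 0 := by
        by_contra hne
        exact Φ.Estar_apply_sub_ne_zero ⟨m, by omega⟩ ⟨m + 1, by omega⟩ k rfl hm hne
          (by rw [hw, map_zero])
      refine ihm (by omega) fun h hh => ?_
      rcases hh.eq_or_lt with he | hlt
      · rwa [show h = ⟨m, by omega⟩ from Fin.ext he.symm]
      · exact hm h hlt

theorem eq_zero_of_mem_splitU (Φ : THSystem K V d) {i : Fin (d + 1)} {v : V}
    (hv : v ∈ splitU Φ i) (hi : Φ.Estar i v = 0) : v = 0 := by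
  rw [mem_splitU_iff] at hv
  refine Φ.eq_zero_of_mem_flags (m := i) (n := d - (i : ℕ) + 1) (by omega) (fun h hh => ?_) hv.2
  rcases hh.eq_or_lt with he | hlt
  · rwa [← Fin.ext he]
  · exact hv.1 h hlt

theorem exists_eq_smul_of_mem_splitU (Φ : THSystem K V d) {i : Fin (d + 1)} {x y : V}
    (hx : x ∈ splitU Φ i) (hx0 : x ≠ 0) (hy : y ∈ splitU Φ i) : ∃ c : K, y = c • x := by
  obtain ⟨c, hc⟩ := exists_idempotent_apply_eq_smul Φ.Es_mul Φ.Es_ne (by simp [Φ.finrank_eq])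
    (fun h => hx0 (Φ.eq_zero_of_mem_splitU hx h)) y
  refine ⟨c, sub_eq_zero.1 (Φ.eq_zero_of_mem_splitU
    (Submodule.sub_mem _ hy (Submodule.smul_mem _ c hx)) ?_)⟩
  simp [hc]

theorem sub_apply_mem_splitU (Φ : THSystem K V d) {i j k : Fin (d + 1)} (hj : (j : ℕ) = i + 1)
    (hk : (k : ℕ) = d - i) {v : V} (hv : v ∈ splitU Φ i) :
    (Φ.A - Φ.θ k • (1 : Module.End K V)) v ∈ splitU Φ j := by
  rw [mem_splitU_iff] at hv ⊢
  refine ⟨fun h hh => Φ.Estar_apply_sub_eq_zero k hv.1 h (by omega), fun h hh =>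
    Φ.E_apply_sub_eq_zero k hk hv.2 h (by omega)⟩

theorem sub_apply_ne_zero (Φ : THSystem K V d) {i : Fin (d + 1)} (k : Fin (d + 1))
    (hi : (i : ℕ) < d) {v : V} (hv : v ∈ splitU Φ i) (hv0 : v ≠ 0) :
    (Φ.A - Φ.θ k • (1 : Module.End K V)) v ≠ 0 := fun h0 =>
  Φ.Estar_apply_sub_ne_zero i ⟨i + 1, by omega⟩ k rfl ((Φ.mem_splitU_iff i v).1 hv).1
    (fun h => hv0 (Φ.eq_zero_of_mem_splitU hv h)) (by rw [h0, map_zero])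

theorem exists_ne_zero_mem_splitU (Φ : THSystem K V d) (i : Fin (d + 1)) :
    ∃ v ∈ splitU Φ i, v ≠ 0 := by
  obtain ⟨n, hn⟩ := i
  induction n with
  | zero =>
    have hex : ∃ u, Φ.Estar 0 u ≠ 0 := by
      by_contra! h
      exact Φ.Es_ne 0 (LinearMap.ext h)
    obtain ⟨u, hu⟩ := hex
    refine ⟨Φ.Estar 0 u, (Φ.mem_splitU_iff _ _).2 ⟨fun h hh => ?_, fun h hh => ?_⟩, hu⟩
    · rw [idempotents_apply_apply Φ.Es_mul, if_neg]
      rintro rfl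
      simp at hh
    · have := h.isLt
      simp only at hh
      omega
  | succ n ih =>
    obtain ⟨v, hv, hv0⟩ := ih (by omega)
    let k : Fin (d + 1) := ⟨d - n, by omega⟩
    exact ⟨_, Φ.sub_apply_mem_splitU (k := k) rfl rfl hv,
      Φ.sub_apply_ne_zero k (by simp only; omega) hv hv0⟩

theorem map_sub_splitU (Φ : THSystem K V d) {i j k : Fin (d + 1)} (hj : (j : ℕ) = i + 1)
    (hk : (k : ℕ) = d - i) :
    Submodule.map (Φ.A - Φ.θ k • (1 : Module.End K V)) (splitU Φ i) = splitU Φ j := by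
  apply le_antisymm
  · rintro _ ⟨v, hv, rfl⟩
    exact Φ.sub_apply_mem_splitU hj hk hv
  · intro w hw
    obtain ⟨v, hv, hv0⟩ := Φ.exists_ne_zero_mem_splitU i
    obtain ⟨c, rfl⟩ := Φ.exists_eq_smul_of_mem_splitU (Φ.sub_apply_mem_splitU hj hk hv)
      (Φ.sub_apply_ne_zero k (by omega) hv hv0) hw
    exact Submodule.smul_mem _ c (Submodule.mem_map_of_mem hv)

theorem map_sub_splitU_last (Φ : THSystem K V d) {i k : Fin (d + 1)} (hi : (i : ℕ) = d)
    (hk : (k : ℕ) = 0) :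
    Submodule.map (Φ.A - Φ.θ k • (1 : Module.End K V)) (splitU Φ i) = ⊥ := by
  rw [eq_bot_iff]
  rintro _ ⟨v, hv, rfl⟩
  refine eq_zero_of_forall_idempotent_apply_eq_zero Φ.sum_E fun h =>
    Φ.E_apply_sub_eq_zero k hk (fun l hl => ((Φ.mem_splitU_iff i v).1 hv).2 l ?_) h
      (Nat.zero_le _)
  omega

theorem finrank_splitU (Φ : THSystem K V d) (i : Fin (d + 1)) :
    Module.finrank K (splitU Φ i) = 1 := by
  obtain ⟨v, hv, hv0⟩ := Φ.exists_ne_zero_mem_splitU i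
  refine finrank_eq_one ⟨v, hv⟩ (by simpa using hv0) fun w => ?_
  obtain ⟨c, hc⟩ := Φ.exists_eq_smul_of_mem_splitU hv hv0 w.2
  exact ⟨c, Subtype.ext hc.symm⟩

theorem linearIndependent_of_mem_splitU (Φ : THSystem K V d) {u : Fin (d + 1) → V}
    (hu : ∀ i, u i ∈ splitU Φ i) (hu0 : ∀ i, u i ≠ 0) : LinearIndependent K u := by
  rw [Fintype.linearIndependent_iff]
  intro g hg
  by_contra! hne
  obtain ⟨i, hi, hmax⟩ := (Set.toFinite {i | g i ≠ 0}).exists_maximal hne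
  have hsum := congrArg (Φ.Estar i) hg
  rw [map_sum, map_zero, Finset.sum_eq_single i, map_smul, smul_eq_zero] at hsum
  · exact hu0 i (Φ.eq_zero_of_mem_splitU (hu i) (hsum.resolve_left hi))
  · intro j _ hj
    rcases lt_or_gt_of_ne hj with hlt | hgt
    · rw [map_smul, ((Φ.mem_splitU_iff j _).1 (hu j)).1 i hlt, smul_zero]
    · have hgj : g j = 0 := by
        by_contra h
        exact absurd (hmax h hgt.le) hgt.not_ge
      simp [hgj]
  · simp

theorem isInternal_splitU (Φ : THSystem K V d) :
    DirectSum.IsInternal fun i : Fin (d + 1) => splitU Φ i := by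
  choose u hu hu0 using Φ.exists_ne_zero_mem_splitU
  have hli := Φ.linearIndependent_of_mem_splitU hu hu0
  have hspan : ∀ i, splitU Φ i = Submodule.span K {u i} := fun i => by
    apply le_antisymm
    · intro w hw
      obtain ⟨c, rfl⟩ := Φ.exists_eq_smul_of_mem_splitU (hu i) (hu0 i) hw
      exact Submodule.smul_mem _ c (Submodule.mem_span_singleton_self _)
    · simpa using hu i
  simp only [hspan]
  refine DirectSum.isInternal_submodule_of_iSupIndep_of_iSup_eq_top
    hli.iSupIndep_span_singleton ?_
  rw [← Submodule.span_range_eq_iSup]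
  exact hli.span_eq_top_of_card_eq_finrank (by simp [Φ.finrank_eq])

end THSystem

/-- The split decomposition: the `U_i` give a direct sum decomposition of `V`
into one-dimensional subspaces, and `(A - θ_{d-i}) U_i = U_{i+1}`,
`(A* - θ*_i) U_i = U_{i-1}` (with `U_{-1} = U_{d+1} = 0`). -/
theorem splitU_decomposition {K V : Type*} [Field K] [AddCommGroup V] [Module K V]
    {d : ℕ} (Φ : THSystem K V d) :
    (DirectSum.IsInternal fun i : Fin (d + 1) => splitU Φ i) ∧
    (∀ i : Fin (d + 1), Module.finrank K (splitU Φ i) = 1) ∧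
    (∀ i : Fin (d + 1),
      Submodule.map (Φ.A - Φ.θ ⟨d - (i : ℕ), by have := i.isLt; omega⟩ • (1 : Module.End K V))
        (splitU Φ i) =
      if h : (i : ℕ) < d then splitU Φ ⟨(i : ℕ) + 1, by omega⟩ else ⊥) ∧
    (∀ i : Fin (d + 1),
      Submodule.map (Φ.Astar - Φ.θs i • (1 : Module.End K V)) (splitU Φ i) =
      if h : 0 < (i : ℕ) then splitU Φ ⟨(i : ℕ) - 1, by have := i.isLt; omega⟩ else ⊥) := by
  refine ⟨Φ.isInternal_splitU, Φ.finrank_splitU, fun i => ?_, fun i => ?_⟩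
  · split_ifs with h
    · exact Φ.map_sub_splitU rfl rfl
    · exact Φ.map_sub_splitU_last (by omega) (by simp only; omega)
  · rw [← Φ.splitU_dual ⟨d - i, by omega⟩ i (by simp only; omega)]
    split_ifs with h
    · rw [← Φ.splitU_dual ⟨d - i + 1, by omega⟩ ⟨i - 1, by omega⟩ (by simp only; omega)]
      exact Φ.dual.map_sub_splitU rfl (by simp only; omega)
    · exact Φ.dual.map_sub_splitU_last (by simp only; omega) (by omega)
end

section
/- Let Φ be a TH system with parameter array ({θ_i}, {θ*_i}, {φ_i}) and let ν be the scalar with ν E_0 E*_0 E_0 = E_0. Then ν = (θ_0-θ_1)(θ_0-θ_2)···(θ_0-θ_d)(θ*_0-θ*_1)(θ*_0-θ*_2)···(θ*_0-θ*_d) / (φ_1 φ_2 ··· φ_d). -/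
/-- `φ` is the split sequence of `Φ`:
`(A - θ_{d-i+1}) (A* - θ*_i)` acts on `U_i` as `φ_i`, for `1 ≤ i ≤ d`. -/
def IsSplitSeq {K V : Type*} [Field K] [AddCommGroup V] [Module K V] {d : ℕ}
    (Φ : THSystem K V d) (φ : Fin (d + 1) → K) : Prop :=
  ∀ i : Fin (d + 1), ∀ hi : 1 ≤ (i : ℕ), ∀ u ∈ splitU Φ i,
    (Φ.A - Φ.θ ⟨d - (i : ℕ) + 1, by have := i.isLt; omega⟩ • (1 : Module.End K V))
      ((Φ.Astar - Φ.θs i • (1 : Module.End K V)) u) = φ i • u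

section IdempotentFamilies

variable {K V : Type*} [Field K] [AddCommGroup V] [Module K V] {d : ℕ}

/-- For a resolution of the identity `F`, a vector killed by `F h` for all `h > k` lies in the sum
of the ranges of the `F h` with `h ≤ k`. -/
theorem mem_iSup_range_of_forall_lt {F : Fin (d + 1) → Module.End K V} (hF : ∑ i, F i = 1) {k : ℕ}
    {x : V} (hx : ∀ h : Fin (d + 1), k < (h : ℕ) → F h x = 0) :
    x ∈ ⨆ h : Fin (d + 1), ⨆ _ : (h : ℕ) ≤ k, LinearMap.range (F h) := by
  have hsum : x = ∑ i, F i x := by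
    rw [← LinearMap.sum_apply, hF, Module.End.one_apply]
  rw [hsum]
  refine Submodule.sum_mem _ fun i _ => ?_
  by_cases hi : (i : ℕ) ≤ k
  · exact Submodule.mem_iSup_of_mem i (Submodule.mem_iSup_of_mem hi ⟨x, rfl⟩)
  · rw [hx i (not_le.mp hi)]
    exact Submodule.zero_mem _

theorem idempotent_apply_sub_smul {F : Fin (d + 1) → Module.End K V}
    (hF : ∀ i j, F i * F j = if i = j then F i else 0) {B : Module.End K V} {t : Fin (d + 1) → K}
    (hB : B = ∑ i, t i • F i) (h : Fin (d + 1)) (c : K) (x : V) :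
    F h ((B - c • (1 : Module.End K V)) x) = (t h - c) • F h x := by
  have hFB : F h * B = t h • F h := by
    rw [hB, Finset.mul_sum]
    simp [hF]
  have hFBx : F h (B x) = t h • F h x := by
    simpa using congrArg (fun G : Module.End K V => G x) hFB
  simp [hFBx, sub_smul]

theorem prod_Ioi_zero_eq_prod_range (f : Fin (d + 1) → K) :
    ∏ i ∈ Finset.Ioi (0 : Fin (d + 1)), f i = ∏ k ∈ Finset.range d, f (Fin.ofNat (d + 1) (k + 1)) := by
  rw [Fin.prod_Ioi_zero, Finset.prod_range]
  refine Finset.prod_congr rfl fun i _ => congrArg f (Fin.ext ?_)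
  simp [Nat.mod_eq_of_lt]

theorem prod_Ioi_zero_eq_prod_range_sub (f : Fin (d + 1) → K) :
    ∏ i ∈ Finset.Ioi (0 : Fin (d + 1)), f i = ∏ k ∈ Finset.range d, f (Fin.ofNat (d + 1) (d - k)) := by
  rw [prod_Ioi_zero_eq_prod_range, ← Finset.prod_range_reflect]
  refine Finset.prod_congr rfl fun k hk => ?_
  have : d - 1 - k + 1 = d - k := by
    have := Finset.mem_range.mp hk
    omega
  rw [this]

end IdempotentFamilies

namespace THSystem

variable {K V : Type*} [Field K] [AddCommGroup V] [Module K V] {d : ℕ}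

/-- The vector `(A* - θ*_{d-n+1}) ⋯ (A* - θ*_{d-1}) (A* - θ*_d) v`. -/
def lowering (Φ : THSystem K V d) (v : V) : ℕ → V
  | 0 => v
  | n + 1 => (Φ.Astar - Φ.θs (Fin.ofNat (d + 1) (d - n)) • (1 : Module.End K V)) (Φ.lowering v n)

theorem Estar_lowering_succ (Φ : THSystem K V d) (v : V) (n : ℕ) (h : Fin (d + 1)) :
    Φ.Estar h (Φ.lowering v (n + 1)) =
      (Φ.θs h - Φ.θs (Fin.ofNat (d + 1) (d - n))) • Φ.Estar h (Φ.lowering v n) :=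
  idempotent_apply_sub_smul Φ.Es_mul Φ.As_eq h _ _

theorem Estar_lowering_eq_zero (Φ : THSystem K V d) (v : V) {n : ℕ} (hn : n ≤ d)
    (h : Fin (d + 1)) (hh : d - n < (h : ℕ)) : Φ.Estar h (Φ.lowering v n) = 0 := by
  induction n with
  | zero => have := h.isLt; omega
  | succ n ih =>
    rw [Estar_lowering_succ]
    by_cases hlt : d - n < (h : ℕ)
    · rw [ih (by omega) hlt, smul_zero]
    · have : Fin.ofNat (d + 1) (d - n) = h := by
        apply Fin.ext
        rw [Fin.val_ofNat, Nat.mod_eq_of_lt (by omega)]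
        omega
      rw [this, sub_self, zero_smul]

theorem E_Astar_apply_eq_zero (Φ : THSystem K V d) {n : ℕ} {x : V}
    (hx : ∀ j : Fin (d + 1), n < (j : ℕ) → Φ.E j x = 0) (h : Fin (d + 1)) (hh : n + 1 < (h : ℕ)) :
    Φ.E h (Φ.Astar x) = 0 := by
  have hsum : x = ∑ j, Φ.E j x := by
    rw [← LinearMap.sum_apply, Φ.sum_E, Module.End.one_apply]
  rw [hsum, map_sum, map_sum]
  refine Finset.sum_eq_zero fun j _ => ?_
  by_cases hj : n < (j : ℕ)
  · rw [hx j hj, map_zero, map_zero]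
  · exact congrArg (fun G : Module.End K V => G x) (Φ.EAsE_zero h j (by omega))

theorem E_lowering_eq_zero (Φ : THSystem K V d) {v : V} (hv : Φ.E 0 v = v) (n : ℕ)
    (h : Fin (d + 1)) (hh : n < (h : ℕ)) : Φ.E h (Φ.lowering v n) = 0 := by
  induction n generalizing h with
  | zero =>
    have h0 : h ≠ 0 := fun h0 => by simp [h0] at hh
    have hmul := congrArg (fun G : Module.End K V => G v) (Φ.E_mul h 0)
    simpa [h0, hv, lowering] using hmul
  | succ n ih =>
    simp [lowering, Φ.E_Astar_apply_eq_zero ih h hh, ih h (by omega)]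

theorem lowering_mem_splitU (Φ : THSystem K V d) {v : V} (hv : Φ.E 0 v = v) {n : ℕ} (hn : n ≤ d) :
    Φ.lowering v n ∈ splitU Φ (Fin.ofNat (d + 1) (d - n)) := by
  have hval : ((Fin.ofNat (d + 1) (d - n) : Fin (d + 1)) : ℕ) = d - n := by
    rw [Fin.val_ofNat, Nat.mod_eq_of_lt (by omega)]
  refine Submodule.mem_inf.mpr ⟨mem_iSup_range_of_forall_lt Φ.sum_Es fun h hh => ?_,
    mem_iSup_range_of_forall_lt Φ.sum_E fun h hh => ?_⟩
  · exact Φ.Estar_lowering_eq_zero v hn h (by omega)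
  · exact Φ.E_lowering_eq_zero hv n h (by omega)

theorem Estar_zero_lowering (Φ : THSystem K V d) (v : V) (n : ℕ) :
    Φ.Estar 0 (Φ.lowering v n) =
      (∏ k ∈ Finset.range n, (Φ.θs 0 - Φ.θs (Fin.ofNat (d + 1) (d - k)))) • Φ.Estar 0 v := by
  induction n with
  | zero => simp [lowering]
  | succ n ih => rw [Estar_lowering_succ, ih, smul_smul, Finset.prod_range_succ, mul_comm]

theorem lowering_last (Φ : THSystem K V d) (v : V) :
    Φ.lowering v d = (∏ i ∈ Finset.Ioi (0 : Fin (d + 1)), (Φ.θs 0 - Φ.θs i)) • Φ.Estar 0 v := by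
  rw [prod_Ioi_zero_eq_prod_range_sub fun i => Φ.θs 0 - Φ.θs i, ← Estar_zero_lowering]
  have hsum : Φ.lowering v d = ∑ j, Φ.Estar j (Φ.lowering v d) := by
    rw [← LinearMap.sum_apply, Φ.sum_Es, Module.End.one_apply]
  conv_lhs => rw [hsum]
  refine Finset.sum_eq_single_of_mem 0 (Finset.mem_univ _) fun j _ hj => ?_
  refine Φ.Estar_lowering_eq_zero v le_rfl j ?_
  have : (j : ℕ) ≠ 0 := fun h0 => hj (Fin.ext h0)
  omega

theorem E_zero_lowering_succ (Φ : THSystem K V d) {φ : Fin (d + 1) → K} (hφ : IsSplitSeq Φ φ)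
    {v : V} (hv : Φ.E 0 v = v) {n : ℕ} (hn : n < d) :
    (Φ.θ 0 - Φ.θ (Fin.ofNat (d + 1) (n + 1))) • Φ.E 0 (Φ.lowering v (n + 1)) =
      φ (Fin.ofNat (d + 1) (d - n)) • Φ.E 0 (Φ.lowering v n) := by
  have hval : ((Fin.ofNat (d + 1) (d - n) : Fin (d + 1)) : ℕ) = d - n := by
    rw [Fin.val_ofNat, Nat.mod_eq_of_lt (by omega)]
  have hsplit := congrArg (Φ.E 0)
    (hφ (Fin.ofNat (d + 1) (d - n)) (by omega) _ (Φ.lowering_mem_splitU hv hn.le))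
  rw [idempotent_apply_sub_smul Φ.E_mul Φ.A_eq, map_smul] at hsplit
  rw [← hsplit]
  congr 3
  apply Fin.ext
  rw [Fin.val_ofNat, Nat.mod_eq_of_lt (by omega)]
  simp only [hval]
  omega

theorem prod_smul_E_zero_lowering (Φ : THSystem K V d) {φ : Fin (d + 1) → K}
    (hφ : IsSplitSeq Φ φ) {v : V} (hv : Φ.E 0 v = v) {n : ℕ} (hn : n ≤ d) :
    (∏ k ∈ Finset.range n, (Φ.θ 0 - Φ.θ (Fin.ofNat (d + 1) (k + 1)))) • Φ.E 0 (Φ.lowering v n) =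
      (∏ k ∈ Finset.range n, φ (Fin.ofNat (d + 1) (d - k))) • v := by
  induction n with
  | zero => simp [lowering, hv]
  | succ n ih =>
    rw [Finset.prod_range_succ, mul_smul, Φ.E_zero_lowering_succ hφ hv (by omega), smul_comm,
      ih (by omega), smul_smul, Finset.prod_range_succ, mul_comm]

theorem prod_smul_E_zero_Estar_zero (Φ : THSystem K V d) {φ : Fin (d + 1) → K}
    (hφ : IsSplitSeq Φ φ) {v : V} (hv : Φ.E 0 v = v) :
    ((∏ i ∈ Finset.Ioi (0 : Fin (d + 1)), (Φ.θ 0 - Φ.θ i)) *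
      ∏ i ∈ Finset.Ioi (0 : Fin (d + 1)), (Φ.θs 0 - Φ.θs i)) • Φ.E 0 (Φ.Estar 0 v) =
      (∏ i ∈ Finset.Ioi (0 : Fin (d + 1)), φ i) • v := by
  rw [mul_smul, ← map_smul, ← lowering_last,
    prod_Ioi_zero_eq_prod_range fun i => Φ.θ 0 - Φ.θ i, prod_Ioi_zero_eq_prod_range_sub φ]
  exact Φ.prod_smul_E_zero_lowering hφ hv le_rfl

end THSystem

/-- `ν = (θ_0-θ_1)⋯(θ_0-θ_d)(θ*_0-θ*_1)⋯(θ*_0-θ*_d) / (φ_1 ⋯ φ_d)`. -/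
theorem nu_formula {K V : Type*} [Field K] [AddCommGroup V] [Module K V]
    {d : ℕ} (Φ : THSystem K V d) (φ : Fin (d + 1) → K) (hφ : IsSplitSeq Φ φ)
    (ν : K) (hν : ν ≠ 0) (h : ν • (Φ.E 0 * Φ.Estar 0 * Φ.E 0) = Φ.E 0) :
    ν = (∏ i ∈ Finset.Ioi (0 : Fin (d + 1)), (Φ.θ 0 - Φ.θ i)) *
        (∏ i ∈ Finset.Ioi (0 : Fin (d + 1)), (Φ.θs 0 - Φ.θs i)) /
        ∏ i ∈ Finset.Ioi (0 : Fin (d + 1)), φ i := by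
  obtain ⟨x, hx⟩ : ∃ x, Φ.E 0 x ≠ 0 := by
    by_contra! hzero
    exact Φ.E_ne 0 (LinearMap.ext hzero)
  have hv : Φ.E 0 (Φ.E 0 x) = Φ.E 0 x := by
    simpa using congrArg (fun G : Module.End K V => G x) (Φ.E_mul 0 0)
  have hνx : ν • Φ.E 0 (Φ.Estar 0 (Φ.E 0 x)) = Φ.E 0 x :=
    congrArg (fun G : Module.End K V => G x) h
  have key := congrArg (ν • ·) (Φ.prod_smul_E_zero_Estar_zero hφ hv)
  rw [smul_comm, hνx, smul_smul] at key
  have hprod := smul_left_injective K hx key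
  have hθ : ∏ i ∈ Finset.Ioi (0 : Fin (d + 1)), (Φ.θ 0 - Φ.θ i) ≠ 0 :=
    Finset.prod_ne_zero_iff.mpr fun i hi =>
      sub_ne_zero.mpr (Φ.θ_inj.ne (Finset.mem_Ioi.mp hi).ne)
  have hθs : ∏ i ∈ Finset.Ioi (0 : Fin (d + 1)), (Φ.θs 0 - Φ.θs i) ≠ 0 :=
    Finset.prod_ne_zero_iff.mpr fun i hi =>
      sub_ne_zero.mpr (Φ.θs_inj.ne (Finset.mem_Ioi.mp hi).ne)
  have hφ_ne : ∏ i ∈ Finset.Ioi (0 : Fin (d + 1)), φ i ≠ 0 :=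
    right_ne_zero_of_mul (hprod ▸ mul_ne_zero hθ hθs)
  exact (eq_div_iff hφ_ne).mpr hprod.symm
end

section
/- Let Φ be a TH system on V and fix nonzero vectors η_0 ∈ E_0 V and η*_0 ∈ E*_0 V. Let D (resp. D*) denote the subalgebra of End(V) generated by A (resp. A*). Then the maps D -> V, X ↦ X η*_0, and D* -> V, X ↦ X η_0, are isomorphisms of K-vector spaces. -/
/-- If a family of `finrank K V` nonzero orthogonal idempotents acts on `V`, then each has
one-dimensional range. -/
theorem OrthogonalIdempotents.exists_smul_eq {K V ι : Type*} [Field K] [AddCommGroup V]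
    [Module K V] [Fintype ι] [DecidableEq ι] [Nonempty ι] {P : ι → Module.End K V}
    (hP : OrthogonalIdempotents P) (hne : ∀ i, P i ≠ 0)
    (hcard : Fintype.card ι = Module.finrank K V) {i : ι} {u x : V}
    (hu : P i u = u) (hu0 : u ≠ 0) (hx : P i x = x) : ∃ c : K, c • u = x := by
  have hmul : ∀ i j y, P i (P j y) = if i = j then P i y else 0 := fun i j y => by
    rw [← Module.End.mul_apply, hP.mul_eq]
    split_ifs <;> rfl
  have hex : ∀ j, ∃ e : V, P j e = e ∧ e ≠ 0 ∧ (j = i → e = u) := fun j => by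
    by_cases hj : j = i
    · subst hj
      exact ⟨u, hu, hu0, fun _ => rfl⟩
    · obtain ⟨y, hy⟩ := DFunLike.ne_iff.1 (hne j)
      exact ⟨P j y, by simp [hmul], hy, fun h => absurd h hj⟩
  choose e he he0 hei using hex
  have hsum : ∀ (g : ι → K) k, P k (∑ j, g j • e j) = g k • e k := fun g k => by
    have hk : ∀ j, P k (e j) = if k = j then e j else 0 := fun j => by
      rw [← he j, hmul]
      split_ifs with h
      · rw [h]
      · rfl
    simp [map_sum, hk]
  have hli : LinearIndependent K e := Fintype.linearIndependent_iff.2 fun g hg k => by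
    have h := hsum g k
    rw [hg, map_zero] at h
    exact (smul_eq_zero.1 h.symm).resolve_right (he0 k)
  have : FiniteDimensional K V :=
    Module.finite_of_finrank_pos (hcard ▸ Fintype.card_pos)
  have hspan := hli.span_eq_top_of_card_eq_finrank' hcard
  have hxs : x ∈ Submodule.span K (Set.range e) := hspan ▸ Submodule.mem_top
  obtain ⟨g, rfl⟩ := (Submodule.mem_span_range_iff_exists_fun K).1 hxs
  exact ⟨g i, by rw [← hx, hsum, hei i rfl]⟩

/-- If `B` is irreducible Hessenberg with respect to a full family of rank-one orthogonal
idempotents `P`, then every `B`-invariant subspace meeting the range of `P 0` nontrivially is the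
whole space. -/
theorem CompleteOrthogonalIdempotents.eq_top_of_hessenberg {K V : Type*} [Field K]
    [AddCommGroup V] [Module K V] {d : ℕ} {P : Fin (d + 1) → Module.End K V}
    (hP : CompleteOrthogonalIdempotents P) (hne : ∀ i, P i ≠ 0)
    (hfin : Module.finrank K V = d + 1) {B : Module.End K V}
    (hzero : ∀ i j : Fin (d + 1), (j : ℕ) + 1 < i → P i * B * P j = 0)
    (hsub : ∀ i j : Fin (d + 1), (i : ℕ) = j + 1 → P i * B * P j ≠ 0)
    {v : V} (hv0 : v ≠ 0) (hv : v ∈ LinearMap.range (P 0))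
    {W : Submodule K V} (hvW : v ∈ W) (hBW : ∀ w ∈ W, B w ∈ W) : W = ⊤ := by
  have hidem : ∀ i x, P i (P i x) = P i x := fun i x =>
    LinearMap.congr_fun (hP.idem i) x
  have hline : ∀ i u x, P i u ∈ W → P i u ≠ 0 → P i x ∈ W := fun i u x huW hu0 => by
    obtain ⟨c, hc⟩ := hP.toOrthogonalIdempotents.exists_smul_eq hne (by simp [hfin])
      (hidem i u) hu0 (hidem i x)
    exact hc ▸ W.smul_mem c huW
  have hdecomp : ∀ x, ∑ i, P i x = x := fun x => by
    rw [← LinearMap.sum_apply, hP.complete, Module.End.one_apply]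
  have hrange : ∀ n (hn : n < d + 1) x, P ⟨n, hn⟩ x ∈ W := by
    intro n
    induction n using Nat.strong_induction_on with
    | _ n ih =>
      intro hn x
      rcases n with _ | n
      · obtain ⟨y, rfl⟩ := hv
        exact hline 0 y x hvW hv0
      · have hn' : n < d + 1 := by omega
        obtain ⟨y, hy⟩ := DFunLike.ne_iff.1 (hsub ⟨n + 1, hn⟩ ⟨n, hn'⟩ rfl)
        refine hline _ (B (P ⟨n, hn'⟩ y)) x ?_ hy
        have hB := hBW _ (ih n (by omega) hn' y)
        have hsplit := hdecomp (B (P ⟨n, hn'⟩ y))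
        rw [← Finset.add_sum_erase _ _ (Finset.mem_univ (⟨n + 1, hn⟩ : Fin (d + 1)))] at hsplit
        rw [eq_sub_of_add_eq hsplit]
        refine W.sub_mem hB (W.sum_mem fun i hi => ?_)
        have hi' : (i : ℕ) ≠ n + 1 := fun h => Finset.ne_of_mem_erase hi (Fin.ext h)
        rcases lt_or_gt_of_ne hi' with h | h
        · exact ih i h i.2 _
        · have hz : P i (B (P ⟨n, hn'⟩ y)) = 0 :=
            LinearMap.congr_fun (hzero i ⟨n, hn'⟩ h) y
          exact hz ▸ W.zero_mem
  exact eq_top_iff.2 fun x _ => hdecomp x ▸ W.sum_mem fun i _ => hrange i i.2 x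

/-- If `v` lies in no proper `B`-invariant subspace, then `X ↦ X v` is a bijection from the algebra
generated by `B` onto `V`. -/
theorem Module.End.bijective_adjoin_apply_of_cyclic {K V : Type*} [Field K] [AddCommGroup V]
    [Module K V] {B : Module.End K V} {v : V}
    (hcyc : ∀ W : Submodule K V, v ∈ W → (∀ w ∈ W, B w ∈ W) → W = ⊤) :
    Function.Bijective (fun X : Algebra.adjoin K {B} => (X : Module.End K V) v) := by
  let f : Algebra.adjoin K {B} →ₗ[K] V :=
    (LinearMap.applyₗ v).comp (Algebra.adjoin K {B}).val.toLinearMap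
  have hB : B ∈ Algebra.adjoin K {B} := Algebra.self_mem_adjoin_singleton K B
  change Function.Bijective f
  constructor
  · refine (injective_iff_map_eq_zero f).2 fun X hX => Subtype.ext ?_
    have hcomm : Commute B (X : Module.End K V) :=
      Algebra.commute_of_mem_adjoin_self X.2
    refine LinearMap.ker_eq_top.1 (hcyc _ hX fun w hw => ?_)
    rw [LinearMap.mem_ker] at hw ⊢
    rw [← Module.End.mul_apply, ← hcomm.eq, Module.End.mul_apply, hw, map_zero]
  · refine LinearMap.range_eq_top.1 (hcyc _ ⟨1, rfl⟩ ?_)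
    rintro _ ⟨X, rfl⟩
    exact ⟨⟨B, hB⟩ * X, rfl⟩

/-- The maps `X ↦ X η*_0` on the subalgebra generated by `A` and `X ↦ X η_0`
on the subalgebra generated by `A*` are vector-space isomorphisms onto `V`. -/
theorem adjoin_acts_bijectively {K V : Type*} [Field K] [AddCommGroup V] [Module K V]
    {d : ℕ} (Φ : THSystem K V d)
    (η₀ ηs₀ : V) (hη : η₀ ≠ 0) (hηs : ηs₀ ≠ 0)
    (hmem : η₀ ∈ LinearMap.range (Φ.E 0)) (hsmem : ηs₀ ∈ LinearMap.range (Φ.Estar 0)) :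
    Function.Bijective
      (fun X : Algebra.adjoin K {Φ.A} => (X : Module.End K V) ηs₀) ∧
    Function.Bijective
      (fun X : Algebra.adjoin K {Φ.Astar} => (X : Module.End K V) η₀) := by
  have hE : CompleteOrthogonalIdempotents Φ.E :=
    ⟨OrthogonalIdempotents.iff_mul_eq.2 Φ.E_mul, Φ.sum_E⟩
  have hEs : CompleteOrthogonalIdempotents Φ.Estar :=
    ⟨OrthogonalIdempotents.iff_mul_eq.2 Φ.Es_mul, Φ.sum_Es⟩
  exact ⟨Module.End.bijective_adjoin_apply_of_cyclic fun _ =>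
      hEs.eq_top_of_hessenberg Φ.Es_ne Φ.finrank_eq Φ.EsAEs_zero Φ.EsAEs_ne hηs hsmem,
    Module.End.bijective_adjoin_apply_of_cyclic fun _ =>
      hE.eq_top_of_hessenberg Φ.E_ne Φ.finrank_eq Φ.EAsE_zero Φ.EAsE_ne hη hmem⟩
end
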